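/- Let (M,≪) be a chronological set and M̄ an admissible completion as a point set, endowed with the chr. topology. Then i(M) = {(I⁻(p),I⁺(p)) : p ∈ M} is dense in M̄: every point of M̄ is the limit, in the chr. topology, of a sequence of points of i(M). -/

import Mathlib

open Filter Set Topology

variable {M : Type*}

/-- The chronological past `I⁻(p)` of a point. -/
def IPast (r : M → M → Prop) (p : M) : Set M := {q | r q p}

/-- The chronological future `I⁺(p)` of a point. -/
def IFut (r : M → M → Prop) (p : M) : Set M := {q | r p q}

/-- The chronological past `I⁻[S]` of a set. -/
def IPastS (r : M → M → Prop) (S : Set M) : Set M := ⋃ s ∈ S, IPast r s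

/-- The chronological future `I⁺[S]` of a set. -/
def IFutS (r : M → M → Prop) (S : Set M) : Set M := ⋃ s ∈ S, IFut r s

/-- A past set: `P = I⁻[P]`. -/
def IsPastSet (r : M → M → Prop) (P : Set M) : Prop := P = IPastS r P

/-- A future set: `F = I⁺[F]`. -/
def IsFutSet (r : M → M → Prop) (F : Set M) : Prop := F = IFutS r F

/-- An indecomposable past set (IP). -/
def IsIP (r : M → M → Prop) (P : Set M) : Prop :=
  P.Nonempty ∧ IsPastSet r P ∧
    ¬∃ P₁ P₂ : Set M, IsPastSet r P₁ ∧ IsPastSet r P₂ ∧ P₁ ⊂ P ∧ P₂ ⊂ P ∧ P = P₁ ∪ P₂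

/-- An indecomposable future set (IF). -/
def IsIF (r : M → M → Prop) (F : Set M) : Prop :=
  F.Nonempty ∧ IsFutSet r F ∧
    ¬∃ F₁ F₂ : Set M, IsFutSet r F₁ ∧ IsFutSet r F₂ ∧ F₁ ⊂ F ∧ F₂ ⊂ F ∧ F = F₁ ∪ F₂

/-- A terminal IP (TIP): an IP which is not of the form `I⁻(p)`. -/
def IsTIP (r : M → M → Prop) (P : Set M) : Prop := IsIP r P ∧ ∀ p : M, P ≠ IPast r p

/-- A terminal IF (TIF). -/
def IsTIF (r : M → M → Prop) (F : Set M) : Prop := IsIF r F ∧ ∀ p : M, F ≠ IFut r p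

/-- The common future `↑P`. -/
def commonFut (r : M → M → Prop) (P : Set M) : Set M := IFutS r {q | ∀ p ∈ P, r p q}

/-- The common past `↓F`. -/
def commonPast (r : M → M → Prop) (F : Set M) : Set M := IPastS r {q | ∀ p ∈ F, r q p}

/-- `P` is a maximal IP contained in `S`. -/
def MaxIPIn (r : M → M → Prop) (P S : Set M) : Prop :=
  IsIP r P ∧ P ⊆ S ∧ ∀ P', IsIP r P' → P' ⊆ S → P ⊆ P' → P = P'

/-- `F` is a maximal IF contained in `S`. -/
def MaxIFIn (r : M → M → Prop) (F S : Set M) : Prop :=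
  IsIF r F ∧ F ⊆ S ∧ ∀ F', IsIF r F' → F' ⊆ S → F ⊆ F' → F = F'

/-- The Szabados relation between (nonempty) indecomposable sets: `F` is a maximal IF
contained in `↑P` and `P` is a maximal IP contained in `↓F`. -/
def SRelNE (r : M → M → Prop) (P F : Set M) : Prop :=
  MaxIFIn r F (commonFut r P) ∧ MaxIPIn r P (commonPast r F)

/-- The full S-relation, allowing one empty component. -/
def SRel (r : M → M → Prop) (P F : Set M) : Prop :=
  SRelNE r P F ∨
    (F = ∅ ∧ IsIP r P ∧ ∀ F', IsIF r F' → ¬SRelNE r P F') ∨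
    (P = ∅ ∧ IsIF r F ∧ ∀ P', IsIP r P' → ¬SRelNE r P' F)

/-- The embedding `i(p) = (I⁻(p), I⁺(p))`. -/
def chrEmb (r : M → M → Prop) (p : M) : Set M × Set M := (IPast r p, IFut r p)

/-- The image `i(M)` inside the set of pairs. -/
def imgM (r : M → M → Prop) : Set (Set M × Set M) := Set.range (chrEmb r)

/-- An admissible completion as a point set. -/
structure IsAdmissibleCompletion (r : M → M → Prop) (Mb : Set (Set M × Set M)) : Prop where
  mem_point : ∀ p : M, chrEmb r p ∈ Mb
  complete_TIP : ∀ P : Set M, IsTIP r P → ∃ x ∈ Mb \ imgM r, x.1 = P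
  complete_TIF : ∀ F : Set M, IsTIF r F → ∃ x ∈ Mb \ imgM r, x.2 = F
  srel : ∀ x ∈ Mb, SRel r x.1 x.2

/-- The extended chronological relation `(P,F) ≪̄ (P',F') ↔ F ∩ P' ≠ ∅`. -/
def extChron (x y : Set M × Set M) : Prop := (x.2 ∩ y.1).Nonempty

/-- A chronology: a transitive and anti-reflexive binary relation. -/
def IsChronology (r : M → M → Prop) : Prop := Transitive r ∧ Irreflexive r

/-- A chronological set: a chronology with no isolates which is chronologically separable. -/
def IsChronologicalSet (r : M → M → Prop) : Prop :=
  IsChronology r ∧ (∀ x, ∃ y, r x y ∨ r y x) ∧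
    ∃ S : Set M, S.Countable ∧ ∀ x y, r x y → ∃ s ∈ S, r x s ∧ r s y
/-- The chronological future of a point of the completion, inside the completion,
with respect to the extended chronological relation. -/
def futIn (Mb : Set (Set M × Set M)) (x : ↥Mb) : Set ↥Mb :=
  {y | extChron (x : Set M × Set M) (y : Set M × Set M)}

/-- The chronological past of a point of the completion, inside the completion. -/
def pastIn (Mb : Set (Set M × Set M)) (x : ↥Mb) : Set ↥Mb :=
  {y | extChron (y : Set M × Set M) (x : Set M × Set M)}

/-- CEAT: the coarsest topology on the completion in which all the sets `I⁺((P,F))`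
and `I⁻((P,F))` are open. -/
def CEAT (Mb : Set (Set M × Set M)) : TopologicalSpace ↥Mb :=
  TopologicalSpace.generateFrom
    ({S | ∃ x : ↥Mb, S = futIn Mb x} ∪ {S | ∃ x : ↥Mb, S = pastIn Mb x})

/-- The set-theoretic inferior limit of a sequence of sets. -/
def setLI (A : ℕ → Set M) : Set M := {x | ∀ᶠ n in Filter.atTop, x ∈ A n}

/-- The set-theoretic superior limit of a sequence of sets. -/
def setLS (A : ℕ → Set M) : Set M := {x | ∃ᶠ n in Filter.atTop, x ∈ A n}

/-- The chronological limit operator (on pairs). -/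
def chrLim (r : M → M → Prop) (σ : ℕ → Set M × Set M) (x : Set M × Set M) : Prop :=
  (x.1 ≠ ∅ → x.1 ⊆ setLI (fun n => (σ n).1) ∧ MaxIPIn r x.1 (setLS fun n => (σ n).1)) ∧
  (x.2 ≠ ∅ → x.2 ⊆ setLI (fun n => (σ n).2) ∧ MaxIFIn r x.2 (setLS fun n => (σ n).2))

/-- The topology derived from a limit operator: closed sets are those containing all the
`L`-limits of their sequences. -/
def derivedTop {X : Type*} (L : (ℕ → X) → Set X)
    (hL : ∀ (σ : ℕ → X) (φ : ℕ → ℕ), StrictMono φ → L σ ⊆ L (σ ∘ φ)) :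
    TopologicalSpace X where
  IsOpen U := ∀ σ : ℕ → X, (∀ n, σ n ∈ Uᶜ) → L σ ⊆ Uᶜ
  isOpen_univ := by
    intro σ h
    simpa using h 0
  isOpen_inter := by
    intro U V hU hV σ hσ x hx
    have h : ∀ n, σ n ∈ Uᶜ ∨ σ n ∈ Vᶜ := by
      intro n
      have h' := hσ n
      rw [Set.compl_inter] at h'
      exact h'
    have hfreq : (∃ᶠ n in Filter.atTop, σ n ∈ Uᶜ) ∨ ∃ᶠ n in Filter.atTop, σ n ∈ Vᶜ :=
      Filter.frequently_or_distrib.mp (Filter.Frequently.of_forall h)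
    rw [Set.compl_inter]
    rcases hfreq with hf | hf
    · obtain ⟨φ, hφ, hmem⟩ := Filter.extraction_of_frequently_atTop hf
      exact Or.inl (hU (σ ∘ φ) hmem (hL σ φ hφ hx))
    · obtain ⟨φ, hφ, hmem⟩ := Filter.extraction_of_frequently_atTop hf
      exact Or.inr (hV (σ ∘ φ) hmem (hL σ φ hφ hx))
  isOpen_sUnion := by
    intro S hS σ hσ x hx
    intro hmem
    rcases hmem with ⟨U, hU, hxU⟩
    exact hS U hU σ (fun n h => hσ n ⟨U, hU, h⟩) hx hxU

lemma setLI_subseq {A : ℕ → Set M} {φ : ℕ → ℕ} (hφ : StrictMono φ) :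
    setLI A ⊆ setLI fun n => A (φ n) :=
  fun _ hx => hφ.tendsto_atTop.eventually hx

lemma setLS_subseq {A : ℕ → Set M} {φ : ℕ → ℕ} (hφ : StrictMono φ) :
    (setLS fun n => A (φ n)) ⊆ setLS A :=
  fun _ hx => hφ.tendsto_atTop.frequently hx

/-- The chronological limit operator on the completion. -/
def chrL (r : M → M → Prop) (Mb : Set (Set M × Set M)) (σ : ℕ → ↥Mb) : Set ↥Mb :=
  {x | chrLim r (fun n => ((σ n : Set M × Set M))) (x : Set M × Set M)}

lemma chrL_subseq (r : M → M → Prop) (Mb : Set (Set M × Set M)) :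
    ∀ (σ : ℕ → ↥Mb) (φ : ℕ → ℕ), StrictMono φ → chrL r Mb σ ⊆ chrL r Mb (σ ∘ φ) := by
  intro σ φ hφ x hx
  obtain ⟨h1, h2⟩ := hx
  constructor
  · intro hne
    obtain ⟨hli, hmax⟩ := h1 hne
    exact ⟨fun y hy => setLI_subseq hφ (hli hy), hmax.1,
      fun y hy => Filter.Eventually.frequently (setLI_subseq hφ (hli hy)),
      fun P' hP' hP'sub hsub => hmax.2.2 P' hP' (fun y hy => setLS_subseq hφ (hP'sub hy)) hsub⟩
  · intro hne
    obtain ⟨hli, hmax⟩ := h2 hne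
    exact ⟨fun y hy => setLI_subseq hφ (hli hy), hmax.1,
      fun y hy => Filter.Eventually.frequently (setLI_subseq hφ (hli hy)),
      fun F' hF' hF'sub hsub => hmax.2.2 F' hF' (fun y hy => setLS_subseq hφ (hF'sub hy)) hsub⟩

/-- The chronological topology on the completion. -/
def chrTop (r : M → M → Prop) (Mb : Set (Set M × Set M)) : TopologicalSpace ↥Mb :=
  derivedTop (chrL r Mb) (chrL_subseq r Mb)

/-- Admissibility condition (A1): chronological futures and pasts are open. -/
def CondA1 (Mb : Set (Set M × Set M)) (τ : TopologicalSpace ↥Mb) : Prop :=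
  ∀ x : ↥Mb, IsOpen[τ] (futIn Mb x) ∧ IsOpen[τ] (pastIn Mb x)

/-- Admissibility condition (A2). -/
def CondA2 (Mb : Set (Set M × Set M)) (τ : TopologicalSpace ↥Mb) : Prop :=
  (∀ (σ : ℕ → ↥Mb) (x : ↥Mb), Filter.Tendsto σ Filter.atTop (@nhds _ τ x) →
      (x : Set M × Set M).2 = ∅ →
      ∀ y : ↥Mb, (x : Set M × Set M).1 ⊆ (y : Set M × Set M).1 →
        (y : Set M × Set M).1 ⊆ setLI (fun n => ((σ n : Set M × Set M)).1) → y = x) ∧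
  (∀ (σ : ℕ → ↥Mb) (x : ↥Mb), Filter.Tendsto σ Filter.atTop (@nhds _ τ x) →
      (x : Set M × Set M).1 = ∅ →
      ∀ y : ↥Mb, (x : Set M × Set M).2 ⊆ (y : Set M × Set M).2 →
        (y : Set M × Set M).2 ⊆ setLI (fun n => ((σ n : Set M × Set M)).2) → y = x)

/-- Admissibility condition (A3): maximal coarseness among (A1)∧(A2) topologies. -/
def CondA3 (Mb : Set (Set M × Set M)) (τ : TopologicalSpace ↥Mb) : Prop :=
  ∀ τ' : TopologicalSpace ↥Mb, CondA1 Mb τ' → CondA2 Mb τ' → ¬(τ < τ')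

lemma mem_IPastS {r : M → M → Prop} {S : Set M} {q : M} :
    q ∈ IPastS r S ↔ ∃ s ∈ S, r q s := by
  simp [IPastS, IPast]

lemma mem_IFutS {r : M → M → Prop} {S : Set M} {q : M} :
    q ∈ IFutS r S ↔ ∃ s ∈ S, r s q := by
  simp [IFutS, IFut]

lemma IsPastSet.mem_iff {r : M → M → Prop} {P : Set M} (hP : IsPastSet r P) {q : M} :
    q ∈ P ↔ ∃ s ∈ P, r q s :=
  (Set.ext_iff.mp hP q).trans mem_IPastS

lemma IsFutSet.mem_iff {r : M → M → Prop} {F : Set M} (hF : IsFutSet r F) {q : M} :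
    q ∈ F ↔ ∃ s ∈ F, r s q :=
  (Set.ext_iff.mp hF q).trans mem_IFutS

lemma isPastSet_IPastS {r : M → M → Prop} (htrans : ∀ ⦃x y z⦄, r x y → r y z → r x z)
    (hdense : ∀ x y, r x y → ∃ z, r x z ∧ r z y) (S : Set M) : IsPastSet r (IPastS r S) := by
  ext q
  simp only [mem_IPastS]
  constructor
  · rintro ⟨s, hs, hqs⟩
    obtain ⟨z, hqz, hzs⟩ := hdense q s hqs
    exact ⟨z, ⟨s, hs, hzs⟩, hqz⟩
  · rintro ⟨z, ⟨s, hs, hzs⟩, hqz⟩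
    exact ⟨s, hs, htrans hqz hzs⟩

lemma IsIP.directed {r : M → M → Prop} (htrans : ∀ ⦃x y z⦄, r x y → r y z → r x z)
    (hdense : ∀ x y, r x y → ∃ z, r x z ∧ r z y) {P : Set M} (hP : IsIP r P) {x y : M}
    (hx : x ∈ P) (hy : y ∈ P) : ∃ z ∈ P, r x z ∧ r y z := by
  obtain ⟨-, hpast, hind⟩ := hP
  by_contra! hno
  have hsub : ∀ S ⊆ P, IPastS r S ⊆ P := fun S hS q hq => by
    obtain ⟨s, hs, hqs⟩ := mem_IPastS.mp hq
    exact hpast.mem_iff.mpr ⟨s, hS hs, hqs⟩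
  refine hind ⟨IPastS r {z ∈ P | r x z}, IPastS r {z ∈ P | ¬r x z},
    isPastSet_IPastS htrans hdense _, isPastSet_IPastS htrans hdense _,
    ⟨hsub _ (sep_subset _ _), fun h => ?_⟩, ⟨hsub _ (sep_subset _ _), fun h => ?_⟩, ?_⟩
  · obtain ⟨z, ⟨hz, hxz⟩, hyz⟩ := mem_IPastS.mp (h hy)
    exact hno z hz hxz hyz
  · obtain ⟨z, hz, hxz⟩ := hpast.mem_iff.mp hx
    obtain ⟨w, ⟨-, hxw⟩, hzw⟩ := mem_IPastS.mp (h hz)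
    exact hxw (htrans hxz hzw)
  · refine Subset.antisymm (fun q hq => ?_)
      (union_subset (hsub _ (sep_subset _ _)) (hsub _ (sep_subset _ _)))
    obtain ⟨s, hs, hqs⟩ := hpast.mem_iff.mp hq
    by_cases hxs : r x s
    · exact Or.inl (mem_IPastS.mpr ⟨s, ⟨hs, hxs⟩, hqs⟩)
    · exact Or.inr (mem_IPastS.mpr ⟨s, ⟨hs, hxs⟩, hqs⟩)

/-- Chronological separability makes every IP the past of a sequence of its points that is
eventually in the future of each of its points. -/
lemma IsIP.exists_seq {r : M → M → Prop}
    (htrans : ∀ ⦃x y z⦄, r x y → r y z → r x z) {S : Set M}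
    (hS : S.Countable) (hsep : ∀ x y, r x y → ∃ s ∈ S, r x s ∧ r s y) {P : Set M}
    (hP : IsIP r P) :
    ∃ p : ℕ → M, (∀ n, p n ∈ P) ∧ ∀ q ∈ P, ∀ᶠ n in atTop, r q (p n) := by
  have hmem : ∀ q ∈ P, ∃ s ∈ S ∩ P, r q s := fun q hq => by
    obtain ⟨z, hz, hqz⟩ := hP.2.1.mem_iff.mp hq
    obtain ⟨s, hs, hqs, hsz⟩ := hsep q z hqz
    exact ⟨s, ⟨hs, hP.2.1.mem_iff.mpr ⟨z, hz, hsz⟩⟩, hqs⟩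
  obtain ⟨a, ha⟩ := hP.1
  obtain ⟨s₀, hs₀, -⟩ := hmem a ha
  obtain ⟨s, hs⟩ := (hS.mono inter_subset_left : (S ∩ P).Countable).exists_eq_range ⟨s₀, hs₀⟩
  have hsP : ∀ n, s n ∈ P := fun n => (hs ▸ mem_range_self n : s n ∈ S ∩ P).2
  have hdir : ∀ x y : P, ∃ z : P, r x z ∧ r y z := fun x y => by
    obtain ⟨z, hz, h⟩ := hP.directed htrans
      (fun u v huv => (hsep u v huv).imp fun _ h => h.2) x.2 y.2
    exact ⟨⟨z, hz⟩, h⟩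
  choose f hf₁ hf₂ using hdir
  let p : ℕ → P := fun n => Nat.rec ⟨a, ha⟩ (fun k x => f x ⟨s k, hsP k⟩) n
  refine ⟨fun n => (p n).1, fun n => (p n).2, fun q hq => ?_⟩
  obtain ⟨t, ht, hqt⟩ := hmem q hq
  rw [hs] at ht
  obtain ⟨k, rfl⟩ := ht
  refine eventually_atTop.mpr ⟨k + 1, fun n hn => ?_⟩
  induction n, hn using Nat.le_induction with
  | base => exact htrans hqt (hf₂ (p k) ⟨s k, hsP k⟩)
  | succ n _ ih => exact htrans ih (hf₁ (p n) ⟨s n, hsP n⟩)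

lemma IsIP.exists_chrLim {r : M → M → Prop}
    (htrans : ∀ ⦃x y z⦄, r x y → r y z → r x z) {S : Set M}
    (hS : S.Countable) (hsep : ∀ x y, r x y → ∃ s ∈ S, r x s ∧ r s y) {P F : Set M}
    (hP : IsIP r P) (hF : F ≠ ∅ → MaxIFIn r F (commonFut r P)) :
    ∃ p : ℕ → M, chrLim r (fun n => chrEmb r (p n)) (P, F) := by
  obtain ⟨p, hpP, hev⟩ := hP.exists_seq htrans hS hsep
  refine ⟨p, fun _ => ⟨hev, hP, fun q hq => (hev q hq).frequently, fun P' _ hP' hPP' => ?_⟩,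
    fun hne => ?_⟩
  · refine hPP'.antisymm fun q hq => ?_
    obtain ⟨n, hn⟩ := (hP' hq).exists
    exact hP.2.1.mem_iff.mpr ⟨p n, hpP n, hn⟩
  · obtain ⟨hIF, hsub, hmax⟩ := hF hne
    have hall : ∀ q ∈ F, ∀ n, r (p n) q := fun q hq n => by
      obtain ⟨z, hz, hzq⟩ := mem_IFutS.mp (hsub hq)
      exact htrans (hz (p n) (hpP n)) hzq
    refine ⟨fun q hq => Eventually.of_forall (hall q hq), hIF,
      fun q hq => Frequently.of_forall (hall q hq), fun F' hF' hF'sub hFF' => ?_⟩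
    refine hmax F' hF' (fun q hq => ?_) hFF'
    obtain ⟨z, hz, hzq⟩ := hF'.2.1.mem_iff.mp hq
    refine mem_IFutS.mpr ⟨z, fun y hy => ?_, hzq⟩
    obtain ⟨n, hn, hyn⟩ := ((hF'sub hz).and_eventually (hev y hy)).exists
    exact htrans hyn hn

lemma SRel.exists_chrLim {r : M → M → Prop} (hchr : IsChronologicalSet r) {P F : Set M}
    (h : SRel r P F) : ∃ p : ℕ → M, chrLim r (fun n => chrEmb r (p n)) (P, F) := by
  obtain ⟨⟨htrans, -⟩, -, S, hS, hsep⟩ := hchr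
  rcases h with ⟨hF, hP⟩ | ⟨hF, hP, -⟩ | ⟨hP, hF, -⟩
  · exact hP.1.exists_chrLim htrans hS hsep fun _ => hF
  · exact hP.exists_chrLim htrans hS hsep fun hne => absurd hF hne
  · have hF' : IsIP (flip r) F := hF
    obtain ⟨p, hp⟩ := hF'.exists_chrLim (r := flip r) (F := P)
      (fun _ _ _ hab hbc => htrans hbc hab) hS
      (fun x y hxy => (hsep y x hxy).imp fun _ h => ⟨h.1, h.2.2, h.2.1⟩)
      fun hne => absurd hP hne
    exact ⟨p, hp.2, hp.1⟩

lemma tendsto_derivedTop {X : Type*} {L : (ℕ → X) → Set X}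
    {hL : ∀ (σ : ℕ → X) (φ : ℕ → ℕ), StrictMono φ → L σ ⊆ L (σ ∘ φ)} {σ : ℕ → X} {x : X}
    (hx : x ∈ L σ) : Tendsto σ atTop (@nhds X (derivedTop L hL) x) := by
  let _ := derivedTop L hL
  refine tendsto_nhds.mpr fun U hU hxU => ?_
  by_contra hσ
  obtain ⟨φ, hφ, hmem⟩ := extraction_of_frequently_atTop (not_eventually.mp hσ)
  exact hU (σ ∘ φ) hmem (hL σ φ hφ hx) hxU

/-- **Theorem.** Let `(M,≪)` be a chronological set and `M̄` an admissible completion as a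
point set, endowed with the chr. topology. Then `i(M)` is dense in `M̄`: every point of `M̄`
is the limit, in the chr. topology, of a sequence of points of `i(M)`. -/
theorem imgM_dense_chrTop
    (r : M → M → Prop) (hchr : IsChronologicalSet r)
    (Mb : Set (Set M × Set M)) (hMb : IsAdmissibleCompletion r Mb) :
    @Dense ↥Mb (chrTop r Mb) {x : ↥Mb | (x : Set M × Set M) ∈ imgM r} ∧
    ∀ x : ↥Mb, ∃ p : ℕ → M,
      Filter.Tendsto (fun n => (⟨chrEmb r (p n), hMb.mem_point (p n)⟩ : ↥Mb))
        Filter.atTop (@nhds _ (chrTop r Mb) x) := by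
  let _ := chrTop r Mb
  have key : ∀ x : ↥Mb, ∃ p : ℕ → M,
      Tendsto (fun n => (⟨chrEmb r (p n), hMb.mem_point (p n)⟩ : ↥Mb)) atTop (𝓝 x) := fun x => by
    obtain ⟨p, hp⟩ := (hMb.srel x x.2).exists_chrLim hchr
    exact ⟨p, tendsto_derivedTop hp⟩
  refine ⟨fun x => ?_, key⟩
  obtain ⟨p, hp⟩ := key x
  exact mem_closure_of_tendsto hp (Eventually.of_forall fun n => mem_range_self (p n))
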